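/- Let n ∈ ℕ, b ∈ ℕ and ℓ ∈ ℕ. Then there exists a constant C > 0, independent of t, such that for all t ≥ 1: if b ≥ 2 then ‖m²_{b,ℓ,L}(·,t)‖₂ ≤ C t^{2(b−1)−1} e^{−t/2} + C t^{−n/4−ℓ}, and if b = 1 then ‖m²_{b,ℓ,L}(·,t)‖₂ ≤ C e^{−t/2} + C t^{−n/4−ℓ}. -/

import Mathlib

open MeasureTheory

/-- `f(r,c,t) = cos(t·√(r²−c))`. -/
noncomputable def fDW (r c t : ℝ) : ℝ := Real.cos (t * Real.sqrt (r ^ 2 - c))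

/-- `g(r,a,t) = exp(−2tr²/(1+√(1−4ar²)))`. -/
noncomputable def gDW (r a t : ℝ) : ℝ :=
  Real.exp (-(2 * t * r ^ 2) / (1 + Real.sqrt (1 - 4 * a * r ^ 2)))

/-- `h(r,a,t) = (1−4ar²)^{−1/2}·exp(−2tr²/(1+√(1−4ar²)))`. -/
noncomputable def hDW (r a t : ℝ) : ℝ :=
  (Real.sqrt (1 - 4 * a * r ^ 2))⁻¹ *
    Real.exp (-(2 * t * r ^ 2) / (1 + Real.sqrt (1 - 4 * a * r ^ 2)))

/-- `W¹_b(ξ,t) = Σ_{k=0}^{b−1} (1/4)^k (1/k!) ∂_c^k f(|ξ|,0,t)` (as a function of `r = |ξ|`). -/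
noncomputable def W1 (b : ℕ) (r t : ℝ) : ℝ :=
  ∑ k ∈ Finset.range b,
    (1/4 : ℝ) ^ k * (1 / (Nat.factorial k) : ℝ) * iteratedDeriv k (fun c => fDW r c t) 0

/-- `W²_b(ξ,t) = 2t⁻¹ Σ_{k=0}^{b−2} (1/4)^k (1/k!) ∂_c^{k+1} f(|ξ|,0,t)` for `b ≥ 2`,
and `W²_1 = 0` (the empty sum). -/
noncomputable def W2 (b : ℕ) (r t : ℝ) : ℝ :=
  2 * t⁻¹ * ∑ k ∈ Finset.range (b - 1),
    (1/4 : ℝ) ^ k * (1 / (Nat.factorial k) : ℝ) * iteratedDeriv (k + 1) (fun c => fDW r c t) 0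

/-- `D¹_ℓ(ξ,t) = (1/2) Σ_{k=0}^{ℓ−1} (1/k!) ∂_a^k g(|ξ|,0,t)`. -/
noncomputable def D1 (l : ℕ) (r t : ℝ) : ℝ :=
  (1/2 : ℝ) * ∑ k ∈ Finset.range l,
    (1 / (Nat.factorial k) : ℝ) * iteratedDeriv k (fun a => gDW r a t) 0

/-- `D²_ℓ(ξ,t) = Σ_{k=0}^{ℓ−1} (1/k!) ∂_a^k h(|ξ|,0,t)`. -/
noncomputable def D2 (l : ℕ) (r t : ℝ) : ℝ :=
  ∑ k ∈ Finset.range l,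
    (1 / (Nat.factorial k) : ℝ) * iteratedDeriv k (fun a => hDW r a t) 0

/-- The Fourier multiplier `K₀(t,ξ)` of the damped wave evolution (as a function of `r = |ξ|`). -/
noncomputable def K0 (t r : ℝ) : ℝ :=
  if r ≤ 1/2 then Real.exp (-t/2) * Real.cosh (t * Real.sqrt (1/4 - r ^ 2))
  else Real.exp (-t/2) * Real.cos (t * Real.sqrt (r ^ 2 - 1/4))

/-- The Fourier multiplier `K₁(t,ξ)` of the damped wave evolution (as a function of `r = |ξ|`). -/
noncomputable def K1 (t r : ℝ) : ℝ :=
  if r < 1/2 then Real.exp (-t/2) * Real.sinh (t * Real.sqrt (1/4 - r ^ 2)) / Real.sqrt (1/4 - r ^ 2)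
  else if r = 1/2 then t * Real.exp (-t/2)
  else Real.exp (-t/2) * Real.sin (t * Real.sqrt (r ^ 2 - 1/4)) / Real.sqrt (r ^ 2 - 1/4)

/-- Iterated derivatives at real points of the real part of a holomorphic function. -/
theorem iteratedDeriv_re_of_differentiableOn {F : ℂ → ℂ} {U : Set ℂ} (hU : IsOpen U)
    (hF : DifferentiableOn ℂ F U) (k : ℕ) (x : ℝ) (hx : (x : ℂ) ∈ U) :
    iteratedDeriv k (fun y : ℝ => (F y).re) x = (iteratedDeriv k F x).re := by
  induction k generalizing x with
  | zero => simp
  | succ k ih =>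
    have hev : iteratedDeriv k (fun y : ℝ => (F y).re) =ᶠ[nhds x]
        fun y : ℝ => (iteratedDeriv k F y).re := by
      have : ∀ᶠ y : ℝ in nhds x, (y : ℂ) ∈ U :=
        Complex.continuous_ofReal.continuousAt.eventually (hU.mem_nhds hx)
      filter_upwards [this] with y hy using ih y hy
    have han : AnalyticAt ℂ F x := hF.analyticAt (hU.mem_nhds hx)
    have hd : DifferentiableAt ℂ (iteratedDeriv k F) x := by
      rw [iteratedDeriv_eq_iterate]
      exact (han.iterated_deriv k).differentiableAt
    rw [iteratedDeriv_succ, iteratedDeriv_succ, hev.deriv_eq]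
    exact hd.hasDerivAt.real_of_complex.deriv

/-- Cauchy's estimate for the real restriction of a holomorphic function on a disc. -/
theorem iteratedDeriv_eq_re_and_norm_le {F : ℂ → ℂ} {f : ℝ → ℝ} {R R' M : ℝ}
    (hR : 0 < R) (hRR' : R < R') (hF : DifferentiableOn ℂ F (Metric.ball 0 R'))
    (hM : ∀ z : ℂ, ‖z‖ = R → ‖F z‖ ≤ M) (hf : f =ᶠ[nhds 0] fun x : ℝ => (F x).re) (k : ℕ) :
    iteratedDeriv k f 0 = (iteratedDeriv k F 0).re ∧
      ‖iteratedDeriv k F 0‖ ≤ k.factorial * M / R ^ k := by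
  constructor
  · rw [hf.iteratedDeriv_eq]
    have := iteratedDeriv_re_of_differentiableOn Metric.isOpen_ball hF k 0
      (by simpa using hR.trans hRR')
    simpa using this
  · refine Complex.norm_iteratedDeriv_le_of_forall_mem_sphere_norm_le k hR ?_
      fun z hz => hM z (by simpa using hz)
    refine DifferentiableOn.diffContOnCl (hF.mono ?_)
    rw [closure_ball _ hR.ne']
    exact Metric.closedBall_subset_ball hRR'

/-- Taylor remainder at `1` for the real restriction of a function holomorphic on a disc. -/
theorem abs_sub_taylor_le_of_holomorphic {F : ℂ → ℂ} {f : ℝ → ℝ} {R R' M : ℝ}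
    (hR : 2 ≤ R) (hRR' : R < R') (hF : DifferentiableOn ℂ F (Metric.ball 0 R'))
    (hM : ∀ z : ℂ, ‖z‖ = R → ‖F z‖ ≤ M) (hf : f =ᶠ[nhds 0] fun x : ℝ => (F x).re)
    (hf1 : f 1 = (F 1).re) (l : ℕ) :
    |f 1 - ∑ k ∈ Finset.range l, (1 / (Nat.factorial k) : ℝ) * iteratedDeriv k f 0|
      ≤ 2 * M / R ^ l := by
  have hR0 : 0 < R := by linarith
  have key := iteratedDeriv_eq_re_and_norm_le hR0 hRR' hF hM hf
  have hM0 : 0 ≤ M := (norm_nonneg _).trans (hM (R : ℂ) (by simp [abs_of_pos hR0]))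
  have hs := Complex.hasSum_taylorSeries_on_ball hF (z := 1) (by simp; linarith)
  have hs' : HasSum (fun k : ℕ => (1 / (Nat.factorial k) : ℝ) * iteratedDeriv k f 0) (f 1) := by
    rw [hf1]
    convert Complex.hasSum_re hs using 2 with k
    rw [(key k).1]
    have : ((k.factorial : ℂ)⁻¹) = (((k.factorial : ℝ)⁻¹ : ℝ) : ℂ) := by push_cast; rfl
    simp only [smul_eq_mul, sub_zero, one_pow, one_mul, this, Complex.re_ofReal_mul]
    simp
  have hs2 := (hasSum_nat_add_iff' l).2 hs'
  have hg : HasSum (fun k : ℕ => M / R ^ l * (1 / 2 : ℝ) ^ k) (M / R ^ l * 2) :=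
    hasSum_geometric_two.mul_left _
  have hb : ∀ k : ℕ, ‖(1 / (Nat.factorial (k + l)) : ℝ) * iteratedDeriv (k + l) f 0‖
      ≤ M / R ^ l * (1 / 2 : ℝ) ^ k := by
    intro k
    have hk := key (k + l)
    have hfac : (0 : ℝ) < (k + l).factorial := by positivity
    rw [norm_mul, hk.1, Real.norm_of_nonneg (by positivity)]
    calc _ ≤ 1 / ((k + l).factorial : ℝ) * (((k + l).factorial : ℝ) * M / R ^ (k + l)) := by
          gcongr
          exact (Complex.abs_re_le_norm _).trans hk.2
      _ = M / R ^ l * (1 / R) ^ k := by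
          rw [one_div_pow, pow_add]
          field_simp
      _ ≤ _ := by gcongr
  have := tsum_of_norm_bounded hg hb
  rw [hs2.tsum_eq, Real.norm_eq_abs] at this
  calc _ ≤ _ := this
    _ = _ := by ring

theorem Complex.norm_cos_le_exp_abs_im (s : ℂ) : ‖Complex.cos s‖ ≤ Real.exp |s.im| := by
  rw [Complex.cos, norm_div, Complex.norm_ofNat, div_le_iff₀ two_pos]
  refine (norm_add_le _ _).trans ?_
  rw [Complex.norm_exp, Complex.norm_exp]
  have h1 : Real.exp (s * Complex.I).re ≤ Real.exp |s.im| := by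
    simpa using neg_le_abs s.im
  have h2 : Real.exp (-s * Complex.I).re ≤ Real.exp |s.im| := by
    simpa using le_abs_self s.im
  linarith

/-- `z ↦ cos √z` is entire. -/
theorem Complex.differentiable_cos_cpow_inv_two :
    Differentiable ℂ fun z : ℂ => Complex.cos (z ^ (2⁻¹ : ℂ)) := by
  rw [← differentiableOn_univ,
    ← Complex.differentiableOn_compl_singleton_and_continuousAt_iff (c := 0) Filter.univ_mem]
  constructor
  · rintro z ⟨-, hz⟩
    have hz0 : z ≠ 0 := hz
    refine DifferentiableAt.differentiableWithinAt ?_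
    by_cases hs : z ∈ Complex.slitPlane
    · exact (DifferentiableAt.cpow_const differentiableAt_id hs).ccos
    · have hneg : -z ∈ Complex.slitPlane := by
        rw [Complex.mem_slitPlane_iff] at hs ⊢
        push Not at hs
        left
        have : z.re ≠ 0 := fun h => hz0 (Complex.ext h hs.2)
        have := lt_of_le_of_ne hs.1 this
        simpa using this
      have hd : DifferentiableAt ℂ (fun w : ℂ => Complex.cos (Complex.I * (-w) ^ (2⁻¹ : ℂ))) z :=
        ((DifferentiableAt.cpow_const differentiableAt_id.neg hneg).const_mul _).ccos
      refine hd.congr_of_eventuallyEq (Filter.Eventually.of_forall fun w => ?_)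
      have h1 : (w ^ (2⁻¹ : ℂ)) ^ 2 = w := by
        simp
      have h2 : ((-w) ^ (2⁻¹ : ℂ)) ^ 2 = -w := by
        simp
      have h3 : (w ^ (2⁻¹ : ℂ)) ^ 2 = (Complex.I * (-w) ^ (2⁻¹ : ℂ)) ^ 2 := by
        rw [mul_pow, h1, h2]; simp
      rcases sq_eq_sq_iff_eq_or_eq_neg.1 h3 with h | h
      · simp only [h]
      · simp only [h, Complex.cos_neg]
  · refine Complex.continuous_cos.continuousAt.comp ?_
    have := (Complex.continuousAt_cpow_zero_of_re_pos (z := (2⁻¹ : ℂ)) (by norm_num))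
    exact this.comp (f := fun z : ℂ => (z, (2⁻¹ : ℂ))) (by fun_prop)

theorem Complex.norm_cos_cpow_inv_two_le {x : ℝ} (hx : 0 ≤ x) {w : ℂ} (hw : ‖w - x‖ ≤ 1) :
    ‖Complex.cos (w ^ (2⁻¹ : ℂ))‖ ≤ Real.exp 1 := by
  refine (Complex.norm_cos_le_exp_abs_im _).trans (Real.exp_le_exp.2 ?_)
  rw [Complex.abs_cpow_inv_two_im, Real.sqrt_le_iff]
  refine ⟨zero_le_one, ?_⟩
  have h1 : ‖w‖ ≤ x + 1 := by
    calc ‖w‖ = ‖(x : ℂ) + (w - x)‖ := by congr 1; ring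
      _ ≤ ‖(x : ℂ)‖ + ‖w - x‖ := norm_add_le _ _
      _ ≤ x + 1 := by simpa [abs_of_nonneg hx] using hw
  have h2 := (Complex.abs_re_le_norm (w - x)).trans hw
  rw [abs_le] at h2
  simp only [Complex.sub_re, Complex.ofReal_re] at h2
  linarith

theorem Complex.ofReal_cpow_inv_two {x : ℝ} (hx : 0 ≤ x) :
    (x : ℂ) ^ (2⁻¹ : ℂ) = (Real.sqrt x : ℂ) := by
  rw [Real.sqrt_eq_rpow, Complex.ofReal_cpow hx]
  norm_num

theorem abs_iteratedDeriv_fDW_le {r t : ℝ} (hr : 0 < r) (ht : 0 < t) (k : ℕ) :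
    |iteratedDeriv k (fun c => fDW r c t) 0| ≤ k.factorial * Real.exp 1 * t ^ (2 * k) := by
  set F : ℂ → ℂ := fun c => Complex.cos (((t ^ 2 : ℝ) * ((r ^ 2 : ℝ) - c)) ^ (2⁻¹ : ℂ)) with hFdef
  have hF : Differentiable ℂ F :=
    Complex.differentiable_cos_cpow_inv_two.comp (f := fun c : ℂ =>
      ((t ^ 2 : ℝ) : ℂ) * (((r ^ 2 : ℝ) : ℂ) - c)) (by fun_prop)
  have hM : ∀ z : ℂ, ‖z‖ = (t ^ 2)⁻¹ → ‖F z‖ ≤ Real.exp 1 := by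
    intro z hz
    refine Complex.norm_cos_cpow_inv_two_le (x := t ^ 2 * r ^ 2) (by positivity) (le_of_eq ?_)
    have : ((t ^ 2 : ℝ) : ℂ) * (((r ^ 2 : ℝ) : ℂ) - z) - ((t ^ 2 * r ^ 2 : ℝ) : ℂ)
        = -(((t ^ 2 : ℝ) : ℂ) * z) := by push_cast; ring
    rw [this, norm_neg, norm_mul, hz, Complex.norm_real, Real.norm_of_nonneg (by positivity)]
    field_simp
  have hf : (fun c => fDW r c t) =ᶠ[nhds 0] fun x : ℝ => (F x).re := by
    filter_upwards [gt_mem_nhds (show (0 : ℝ) < r ^ 2 by positivity)] with c hc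
    have h0 : 0 ≤ r ^ 2 - c := by linarith
    have : F c = (Real.cos (t * Real.sqrt (r ^ 2 - c)) : ℂ) := by
      simp only [hFdef]
      rw [← Complex.ofReal_sub, ← Complex.ofReal_mul, Complex.ofReal_cpow_inv_two (by positivity),
        Real.sqrt_mul (by positivity), Real.sqrt_sq ht.le, Complex.ofReal_cos]
    rw [this, Complex.ofReal_re, fDW]
  obtain ⟨h1, h2⟩ := iteratedDeriv_eq_re_and_norm_le (R := (t ^ 2)⁻¹) (R' := (t ^ 2)⁻¹ + 1)
    (by positivity) (by linarith) hF.differentiableOn hM hf k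
  rw [h1]
  refine (Complex.abs_re_le_norm _).trans (h2.trans (le_of_eq ?_))
  rw [inv_pow, div_inv_eq_mul, ← pow_mul]

theorem abs_hDW_sub_D2_le {r t : ℝ} (hr : 0 < r) (hr3 : r ≤ 1 / 3) (ht : 0 ≤ t) (l : ℕ) :
    |hDW r 1 t - D2 l r t| ≤ 6 * (9 / 2 * r ^ 2) ^ l * Real.exp (-(2 / 9 * t * r ^ 2)) := by
  set s : ℂ → ℂ := fun a => (1 - 4 * a * (r ^ 2 : ℝ)) ^ (2⁻¹ : ℂ) with hs
  set F : ℂ → ℂ := fun a =>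
    (s a)⁻¹ * Complex.exp (-((2 * t * r ^ 2 : ℝ) : ℂ) / (1 + s a)) with hFdef
  have hr2 : r ^ 2 ≤ 1 / 9 := by nlinarith
  have hr2' : 0 < r ^ 2 := by positivity
  have hsre : ∀ a, 0 ≤ (s a).re := fun a => by
    simp only [hs, Complex.cpow_inv_two_re]; positivity
  have hssq : ∀ a, s a ^ 2 = 1 - 4 * a * (r ^ 2 : ℝ) := fun a => by
    simp [hs]
  have hnorm : ∀ a : ℂ, ‖4 * a * (r ^ 2 : ℝ)‖ = 4 * ‖a‖ * r ^ 2 := fun a => by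
    rw [norm_mul, norm_mul, Complex.norm_real, Real.norm_of_nonneg hr2'.le]; simp
  have hF : DifferentiableOn ℂ F (Metric.ball 0 (1 / (4 * r ^ 2))) := by
    intro a ha
    have ha' : ‖a‖ < 1 / (4 * r ^ 2) := by simpa using ha
    have hlt : ‖4 * a * (r ^ 2 : ℝ)‖ < 1 := by
      rw [hnorm]; rw [lt_div_iff₀ (by positivity)] at ha'; linarith
    have hslit : 1 - 4 * a * (r ^ 2 : ℝ) ∈ Complex.slitPlane := by
      left
      have := (Complex.re_le_norm (4 * a * (r ^ 2 : ℝ))).trans_lt hlt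
      rw [Complex.sub_re, Complex.one_re]; linarith
    have hds : DifferentiableAt ℂ s a := DifferentiableAt.cpow_const (by fun_prop) hslit
    have h0 : s a ≠ 0 := fun h => by
      have := hssq a
      rw [h] at this
      exact Complex.slitPlane_ne_zero hslit (by rw [← this]; simp)
    have h1 : 1 + s a ≠ 0 := fun h => by
      have := hsre a
      have h' := congrArg Complex.re h
      simp at h'; linarith
    exact ((hds.inv h0).mul (((differentiableAt_const _).div
      (hds.const_add 1) h1).cexp)).differentiableWithinAt
  have hM : ∀ a : ℂ, ‖a‖ = 2 / (9 * r ^ 2) → ‖F a‖ ≤ 3 * Real.exp (-(2 / 9 * t * r ^ 2)) := by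
    intro a ha
    have hn : ‖4 * a * (r ^ 2 : ℝ)‖ = 8 / 9 := by
      rw [hnorm, ha]; field_simp; norm_num
    have hlow : 1 / 9 ≤ ‖s a‖ ^ 2 := by
      rw [← norm_pow, hssq]
      have := norm_sub_norm_le (1 : ℂ) (4 * a * (r ^ 2 : ℝ))
      rw [hn, norm_one] at this; linarith
    have hup : ‖s a‖ ^ 2 ≤ 4 := by
      rw [← norm_pow, hssq]
      have := norm_sub_le (1 : ℂ) (4 * a * (r ^ 2 : ℝ))
      rw [hn, norm_one] at this; linarith
    have hlow' : 1 / 3 ≤ ‖s a‖ := by nlinarith [norm_nonneg (s a)]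
    have hup' : ‖s a‖ ≤ 2 := by nlinarith [norm_nonneg (s a)]
    have hsum : ‖1 + s a‖ ≤ 3 := (norm_add_le _ _).trans (by rw [norm_one]; linarith)
    have hre1 : 1 ≤ (1 + s a).re := by
      rw [Complex.add_re, Complex.one_re]; linarith [hsre a]
    have hpos : 0 < ‖1 + s a‖ := by linarith [Complex.re_le_norm (1 + s a)]
    have hinv : 1 / 9 ≤ ((1 + s a)⁻¹).re := by
      rw [Complex.inv_re, Complex.normSq_eq_norm_sq, div_le_div_iff₀ (by norm_num) (by positivity)]
      nlinarith
    rw [hFdef, norm_mul, norm_inv, Complex.norm_exp]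
    gcongr
    · rw [inv_le_comm₀ (by linarith) (by norm_num)]; linarith
    · rw [neg_div, Complex.neg_re, div_eq_mul_inv, Complex.re_ofReal_mul, neg_le_neg_iff]
      have : 0 ≤ 2 * t * r ^ 2 := by positivity
      nlinarith
  have heq : ∀ x : ℝ, x < 1 / (4 * r ^ 2) → hDW r x t = (F x).re := by
    intro x hx
    rw [lt_div_iff₀ (by positivity)] at hx
    have h0 : 0 ≤ 1 - 4 * x * r ^ 2 := by linarith
    have hsx : s x = (Real.sqrt (1 - 4 * x * r ^ 2) : ℂ) := by
      rw [← Complex.ofReal_cpow_inv_two h0]; simp [hs]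
    have : F x = (hDW r x t : ℂ) := by
      simp only [hFdef, hsx, hDW]; push_cast; rfl
    rw [this, Complex.ofReal_re]
  have h := abs_sub_taylor_le_of_holomorphic (f := fun a => hDW r a t) (R := 2 / (9 * r ^ 2))
    (R' := 1 / (4 * r ^ 2)) ?_ ?_ hF hM ?_ ?_ l
  · refine h.trans (le_of_eq ?_)
    rw [show (9 / 2 * r ^ 2) = (2 / (9 * r ^ 2))⁻¹ by field_simp, inv_pow]
    field_simp
    ring
  · rw [le_div_iff₀ (by positivity)]; linarith
  · rw [div_lt_div_iff₀ (by positivity) (by positivity)]; linarith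
  · filter_upwards [gt_mem_nhds (show (0 : ℝ) < 1 / (4 * r ^ 2) by positivity)] with x hx
    exact heq x hx
  · have := heq 1 (by rw [lt_div_iff₀ (by positivity)]; linarith)
    simpa using this

theorem abs_W2_le {b : ℕ} {r t : ℝ} (hr : 0 < r) (ht : 1 ≤ t) :
    |W2 b r t| ≤ (2 * ∑ k ∈ Finset.range (b - 1), (1 / 4 : ℝ) ^ k * (1 / (Nat.factorial k) : ℝ) *
      ((k + 1).factorial * Real.exp 1)) * (t ^ (2 * (b - 1)) * t⁻¹) := by
  have ht0 : 0 < t := by linarith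
  rw [W2, abs_mul, abs_of_pos (by positivity : 0 < 2 * t⁻¹)]
  have : |∑ k ∈ Finset.range (b - 1), (1 / 4 : ℝ) ^ k * (1 / (Nat.factorial k) : ℝ) *
        iteratedDeriv (k + 1) (fun c => fDW r c t) 0| ≤
      (∑ k ∈ Finset.range (b - 1), (1 / 4 : ℝ) ^ k * (1 / (Nat.factorial k) : ℝ) *
        ((k + 1).factorial * Real.exp 1)) * t ^ (2 * (b - 1)) := by
    rw [Finset.sum_mul]
    refine (Finset.abs_sum_le_sum_abs _ _).trans (Finset.sum_le_sum fun k hk => ?_)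
    rw [Finset.mem_range] at hk
    rw [abs_mul, abs_of_pos (by positivity), mul_assoc _ _ (t ^ (2 * (b - 1)))]
    gcongr
    refine (abs_iteratedDeriv_fDW_le hr ht0 (k + 1)).trans ?_
    gcongr
    omega
  calc _ ≤ 2 * t⁻¹ * _ := mul_le_mul_of_nonneg_left this (by positivity)
    _ = _ := by ring

theorem abs_K1_sub_hDW_le {r t : ℝ} (hr : 0 < r) (hr3 : r ≤ 1 / 3) (ht : 0 ≤ t) :
    |K1 t r - hDW r 1 t| ≤ 2 * Real.exp (-t / 2) := by
  have hr2 : r ^ 2 ≤ 1 / 9 := by nlinarith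
  set s := Real.sqrt (1 / 4 - r ^ 2) with hs
  have hs2 : s ^ 2 = 1 / 4 - r ^ 2 := Real.sq_sqrt (by linarith)
  have hs0 : 0 ≤ s := Real.sqrt_nonneg _
  have hs4 : 1 / 4 ≤ s := Real.le_sqrt_of_sq_le (by norm_num; linarith)
  have h2s : Real.sqrt (1 - 4 * 1 * r ^ 2) = 2 * s := by
    rw [show 1 - 4 * 1 * r ^ 2 = (2 * s) ^ 2 by rw [mul_pow, hs2]; ring,
      Real.sqrt_sq (by positivity)]
  have hexp : -(2 * t * r ^ 2) / (1 + 2 * s) = -t / 2 + t * s := by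
    rw [div_eq_iff (by positivity)]
    linear_combination (-2 * t) * hs2
  have hdiff : K1 t r - hDW r 1 t =
      -(Real.exp (-t / 2) * (Real.exp (-(t * s)) * (2 * s)⁻¹)) := by
    rw [K1, if_pos (by linarith), hDW, h2s, hexp, ← hs, Real.sinh_eq, Real.exp_add]
    field_simp
    ring
  rw [hdiff, abs_neg, abs_of_nonneg (by positivity), mul_comm]
  gcongr
  calc _ ≤ 1 * (1 / 2 : ℝ)⁻¹ := by
        gcongr
        · rw [Real.exp_le_one_iff]; nlinarith
        · linarith
    _ = 2 := by norm_num

/-- Pointwise bound for the low-frequency symbol away from the origin. -/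
theorem abs_symbol_le {b l : ℕ} {r t A : ℝ} (hr : 0 < r) (hr3 : r ≤ 1 / 3) (ht : 1 ≤ t)
    (hW : |W2 b r t| ≤ A) :
    |K1 t r - Real.exp (-t / 2) * W2 b r t - D2 l r t| ≤
      (2 + A) * Real.exp (-t / 2) +
        6 * (81 / 2) ^ l * l.factorial * t ^ (-(l : ℝ)) * Real.exp (-(t / 9) * r ^ 2) := by
  have ht0 : 0 < t := by linarith
  have h1 := abs_K1_sub_hDW_le hr hr3 ht0.le
  have h2 := abs_hDW_sub_D2_le hr hr3 ht0.le l
  have h3 : |Real.exp (-t / 2) * W2 b r t| ≤ A * Real.exp (-t / 2) := by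
    rw [abs_mul, abs_of_pos (Real.exp_pos _), mul_comm]
    gcongr
  have h4 : 6 * (9 / 2 * r ^ 2) ^ l * Real.exp (-(2 / 9 * t * r ^ 2)) ≤
      6 * (81 / 2) ^ l * l.factorial * t ^ (-(l : ℝ)) * Real.exp (-(t / 9) * r ^ 2) := by
    have hx : 0 ≤ t / 9 * r ^ 2 := by positivity
    have hfac := Real.pow_div_factorial_le_exp _ hx l
    rw [div_le_iff₀ (by positivity)] at hfac
    rw [Real.rpow_neg ht0.le, Real.rpow_natCast]
    have e1 : (9 / 2 * r ^ 2) ^ l = (81 / 2) ^ l * (t ^ l)⁻¹ * (t / 9 * r ^ 2) ^ l := by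
      rw [← inv_pow, ← mul_pow, ← mul_pow]
      congr 1
      field_simp
      norm_num
    have e2 : Real.exp (-(2 / 9 * t * r ^ 2)) =
        (Real.exp (t / 9 * r ^ 2))⁻¹ * Real.exp (-(t / 9) * r ^ 2) := by
      rw [← Real.exp_neg, ← Real.exp_add]; congr 1; ring
    rw [e1, e2]
    calc _ = 6 * (81 / 2) ^ l * (t ^ l)⁻¹ * Real.exp (-(t / 9) * r ^ 2) *
          ((t / 9 * r ^ 2) ^ l * (Real.exp (t / 9 * r ^ 2))⁻¹) := by ring
      _ ≤ 6 * (81 / 2) ^ l * (t ^ l)⁻¹ * Real.exp (-(t / 9) * r ^ 2) *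
          ((Real.exp (t / 9 * r ^ 2) * l.factorial) * (Real.exp (t / 9 * r ^ 2))⁻¹) := by gcongr
      _ = _ := by field_simp
  have e : K1 t r - Real.exp (-t / 2) * W2 b r t - D2 l r t =
      (K1 t r - hDW r 1 t) - Real.exp (-t / 2) * W2 b r t + (hDW r 1 t - D2 l r t) := by ring
  rw [e]
  refine (abs_add_le _ _).trans ?_
  have := abs_sub (K1 t r - hDW r 1 t) (Real.exp (-t / 2) * W2 b r t)
  linarith

theorem eLpNorm_two_gaussian {V : Type*} [NormedAddCommGroup V] [InnerProductSpace ℝ V]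
    [FiniteDimensional ℝ V] [MeasurableSpace V] [BorelSpace V] {c : ℝ} (hc : 0 < c) :
    eLpNorm (fun v : V => Real.exp (-c * ‖v‖ ^ 2)) 2 volume =
      ENNReal.ofReal ((Real.pi / (2 * c)) ^ ((Module.finrank ℝ V : ℝ) / 4)) := by
  have hc2 : 0 < 2 * c := by positivity
  have hint := GaussianFourier.integral_rexp_neg_mul_sq_norm (V := V) hc2
  have hsq : ∀ v : V, ‖Real.exp (-c * ‖v‖ ^ 2)‖ ^ (2 : ℝ) = Real.exp (-(2 * c) * ‖v‖ ^ 2) := by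
    intro v
    rw [Real.norm_of_nonneg (Real.exp_pos _).le, ← Real.exp_mul]
    congr 1; ring
  have hI : Integrable (fun v : V => Real.exp (-(2 * c) * ‖v‖ ^ 2)) volume := by
    by_contra h
    rw [integral_undef h] at hint
    exact (Real.rpow_pos_of_pos (by positivity) _).ne hint
  have hmeas : AEStronglyMeasurable (fun v : V => Real.exp (-c * ‖v‖ ^ 2)) volume :=
    (by fun_prop : Continuous _).aestronglyMeasurable
  have hmem : MemLp (fun v : V => Real.exp (-c * ‖v‖ ^ 2)) 2 volume := by
    rw [← integrable_norm_rpow_iff hmeas two_ne_zero ENNReal.ofNat_ne_top]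
    simpa only [ENNReal.toReal_ofNat, hsq] using hI
  rw [hmem.eLpNorm_eq_integral_rpow_norm two_ne_zero ENNReal.ofNat_ne_top]
  simp only [ENNReal.toReal_ofNat, hsq, hint]
  rw [← Real.rpow_mul (by positivity)]
  congr 2
  ring

/-- The low-frequency `L²` estimate, given a uniform bound `A` on the wave profile. -/
theorem eLpNorm_low_le {n b l : ℕ} (hn : 1 ≤ n) {χ : ℝ → ℝ} (hχ0 : ∀ r, 0 ≤ χ r)
    (hχ1 : ∀ r, χ r ≤ 1) (hχzero : ∀ r, 1 / 3 ≤ r → χ r = 0) {t A : ℝ} (ht : 1 ≤ t)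
    (hA : 0 ≤ A) (hW : ∀ r, 0 < r → |W2 b r t| ≤ A) :
    eLpNorm (fun ξ : EuclideanSpace ℝ (Fin n) =>
        χ ‖ξ‖ * (K1 t ‖ξ‖ - Real.exp (-t / 2) * W2 b ‖ξ‖ t - D2 l ‖ξ‖ t)) 2 volume ≤
      ENNReal.ofReal
        ((volume (Metric.ball (0 : EuclideanSpace ℝ (Fin n)) 1)).toReal ^ (1 / 2 : ℝ) *
            ((2 + A) * Real.exp (-t / 2)) +
          6 * (81 / 2) ^ l * l.factorial * (9 * Real.pi / 2) ^ ((n : ℝ) / 4) *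
            t ^ (-(n : ℝ) / 4 - (l : ℝ))) := by
  have ht0 : 0 < t := by linarith
  have : Nonempty (Fin n) := ⟨⟨0, hn⟩⟩
  set B : ℝ := 6 * (81 / 2) ^ l * l.factorial * t ^ (-(l : ℝ)) with hB
  set E := EuclideanSpace ℝ (Fin n)
  set u : E → ℝ := (Metric.ball (0 : E) 1).indicator fun _ => (2 + A) * Real.exp (-t / 2) with hu
  set v : E → ℝ := fun ξ => Real.exp (-(t / 9) * ‖ξ‖ ^ 2) with hv
  have hB0 : 0 ≤ B := by positivity
  have hpt : ∀ᵐ ξ : E, ‖χ ‖ξ‖ * (K1 t ‖ξ‖ - Real.exp (-t / 2) * W2 b ‖ξ‖ t - D2 l ‖ξ‖ t)‖ ≤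
      (u + B • v) ξ := by
    have hne : ∀ᵐ ξ : E, ξ ≠ 0 := by
      simp [ae_iff]
    filter_upwards [hne] with ξ hξ
    have hr : 0 < ‖ξ‖ := norm_pos_iff.2 hξ
    have hu0 : 0 ≤ u ξ := Set.indicator_nonneg (fun _ _ => by positivity) _
    have hv0 : 0 ≤ v ξ := (Real.exp_pos _).le
    rw [Pi.add_apply, Pi.smul_apply, smul_eq_mul]
    rcases le_or_gt (1 / 3) ‖ξ‖ with h | h
    · rw [hχzero _ h, zero_mul, norm_zero]
      positivity
    · have hball : ξ ∈ Metric.ball (0 : E) 1 := by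
        rw [mem_ball_zero_iff]; linarith
      have hval : u ξ = (2 + A) * Real.exp (-t / 2) := Set.indicator_of_mem hball _
      rw [norm_mul, Real.norm_of_nonneg (hχ0 _), hval]
      calc _ ≤ 1 * |K1 t ‖ξ‖ - Real.exp (-t / 2) * W2 b ‖ξ‖ t - D2 l ‖ξ‖ t| :=
            mul_le_mul_of_nonneg_right (hχ1 _) (abs_nonneg _)
        _ ≤ _ := by
            rw [one_mul]
            exact abs_symbol_le hr h.le ht (hW _ hr)
  have hvm : AEStronglyMeasurable v volume := (by fun_prop : Continuous v).aestronglyMeasurable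
  have hum : AEStronglyMeasurable u volume :=
    aestronglyMeasurable_const.indicator Metric.isOpen_ball.measurableSet
  have hu2 : eLpNorm u 2 volume ≤ ENNReal.ofReal
      ((volume (Metric.ball (0 : E) 1)).toReal ^ (1 / 2 : ℝ) * ((2 + A) * Real.exp (-t / 2))) := by
    refine (eLpNorm_indicator_const_le _ _).trans (le_of_eq ?_)
    rw [Real.enorm_of_nonneg (by positivity), mul_comm,
      ENNReal.ofReal_mul (p := _ ^ (1 / 2 : ℝ)) (by positivity),
      ← ENNReal.ofReal_rpow_of_nonneg ENNReal.toReal_nonneg (by norm_num),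
      ENNReal.ofReal_toReal measure_ball_lt_top.ne]
    simp
  have hv2 : eLpNorm (B • v) 2 volume ≤ ENNReal.ofReal
      (6 * (81 / 2) ^ l * l.factorial * (9 * Real.pi / 2) ^ ((n : ℝ) / 4) *
        t ^ (-(n : ℝ) / 4 - (l : ℝ))) := by
    rw [eLpNorm_const_smul, eLpNorm_two_gaussian (by positivity), Real.enorm_of_nonneg hB0,
      ← ENNReal.ofReal_mul hB0, finrank_euclideanSpace_fin]
    refine ENNReal.ofReal_le_ofReal (le_of_eq ?_)
    rw [show Real.pi / (2 * (t / 9)) = (9 * Real.pi / 2) * t⁻¹ by field_simp,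
      Real.mul_rpow (by positivity) (by positivity), Real.inv_rpow ht0.le, ← Real.rpow_neg ht0.le,
      hB, sub_eq_add_neg, Real.rpow_add ht0, neg_div]
    ring
  refine (eLpNorm_mono_ae_real hpt).trans ((eLpNorm_add_le hum (hvm.const_smul B)
    one_le_two).trans ((add_le_add hu2 hv2).trans (le_of_eq ?_)))
  rw [ENNReal.ofReal_add (by positivity) (by positivity)]

/-- Low-frequency estimate for `m²_{b,ℓ,L}`: for `b ≥ 2`,
`‖m²_{b,ℓ,L}(·,t)‖₂ ≤ C t^{2(b−1)−1} e^{−t/2} + C t^{−n/4−ℓ}`, and for `b = 1`,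
`‖m²_{b,ℓ,L}(·,t)‖₂ ≤ C e^{−t/2} + C t^{−n/4−ℓ}`. -/
theorem stmt_4 (n b l : ℕ) (hn : 1 ≤ n) (hb : 1 ≤ b) (hl : 1 ≤ l)
    (χL χH : ℝ → ℝ) (hχLsmooth : ContDiff ℝ (⊤ : ℕ∞) χL) (hχHsmooth : ContDiff ℝ (⊤ : ℕ∞) χH)
    (hχL0 : ∀ r : ℝ, 0 ≤ χL r) (hχL1 : ∀ r : ℝ, χL r ≤ 1)
    (hχH0 : ∀ r : ℝ, 0 ≤ χH r) (hχH1 : ∀ r : ℝ, χH r ≤ 1)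
    (hχLone : ∀ r : ℝ, r ≤ 1/4 → χL r = 1) (hχLzero : ∀ r : ℝ, 1/3 ≤ r → χL r = 0)
    (hχHzero : ∀ r : ℝ, r ≤ 1 → χH r = 0) (hχHone : ∀ r : ℝ, 2 ≤ r → χH r = 1) :
    ∃ C : ℝ, 0 < C ∧ ∀ t : ℝ, 1 ≤ t →
      (2 ≤ b →
        eLpNorm
          (fun ξ : EuclideanSpace ℝ (Fin n) =>
            χL ‖ξ‖ * (K1 t ‖ξ‖ - Real.exp (-t/2) * W2 b ‖ξ‖ t - D2 l ‖ξ‖ t)) 2 volume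
        ≤ ENNReal.ofReal (C * t ^ (2 * ((b : ℝ) - 1) - 1) * Real.exp (-t/2)
            + C * t ^ (-(n : ℝ)/4 - (l : ℝ)))) ∧
      (b = 1 →
        eLpNorm
          (fun ξ : EuclideanSpace ℝ (Fin n) =>
            χL ‖ξ‖ * (K1 t ‖ξ‖ - Real.exp (-t/2) * W2 b ‖ξ‖ t - D2 l ‖ξ‖ t)) 2 volume
        ≤ ENNReal.ofReal (C * Real.exp (-t/2)
            + C * t ^ (-(n : ℝ)/4 - (l : ℝ)))) := by

  set Cw : ℝ := 2 * ∑ k ∈ Finset.range (b - 1), (1 / 4 : ℝ) ^ k * (1 / (Nat.factorial k) : ℝ) *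
      ((k + 1).factorial * Real.exp 1) with hCw
  have hCw0 : 0 ≤ Cw := by positivity
  set V : ℝ := (volume (Metric.ball (0 : EuclideanSpace ℝ (Fin n)) 1)).toReal ^ (1 / 2 : ℝ)
  have hV : 0 ≤ V := by positivity
  set G : ℝ := 6 * (81 / 2) ^ l * l.factorial * (9 * Real.pi / 2) ^ ((n : ℝ) / 4)
  have hG : 0 < G := by positivity
  have hC1 : V * (2 + Cw) ≤ V * (2 + Cw) + G := by linarith
  have hC2 : G ≤ V * (2 + Cw) + G := by nlinarith
  refine ⟨V * (2 + Cw) + G, by positivity, fun t ht => ?_⟩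
  have ht0 : 0 < t := by linarith
  constructor
  · intro hb2
    have hexp : t ^ (2 * (b - 1)) * t⁻¹ = t ^ (2 * ((b : ℝ) - 1) - 1) := by
      rw [Real.rpow_sub ht0, Real.rpow_one, div_eq_mul_inv, ← Real.rpow_natCast]
      push_cast [Nat.cast_sub hb]
      rfl
    set P : ℝ := t ^ (2 * ((b : ℝ) - 1) - 1)
    have hP : 1 ≤ P := by
      refine Real.one_le_rpow ht ?_
      have : (2 : ℝ) ≤ b := by exact_mod_cast hb2
      linarith
    refine (eLpNorm_low_le hn hχL0 hχL1 hχLzero ht (A := Cw * P) (by positivity)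
      fun r hr => ?_).trans (ENNReal.ofReal_le_ofReal ?_)
    · rw [← hexp]; exact abs_W2_le hr ht
    · refine add_le_add ?_ (mul_le_mul_of_nonneg_right hC2 (by positivity))
      calc _ ≤ V * ((2 * P + Cw * P) * Real.exp (-t / 2)) := by
            gcongr; linarith
        _ = V * (2 + Cw) * P * Real.exp (-t / 2) := by ring
        _ ≤ _ := by gcongr
  · intro hb1
    refine (eLpNorm_low_le hn hχL0 hχL1 hχLzero ht (A := Cw) hCw0
      fun r hr => ?_).trans (ENNReal.ofReal_le_ofReal ?_)
    · simpa [W2, hb1] using hCw0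
    · refine add_le_add ?_ (mul_le_mul_of_nonneg_right hC2 (by positivity))
      rw [← mul_assoc]
      gcongr
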